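/- arXiv:2312.15336 — 3 statements merged into one kernel-verified Lean document; each statement's English description precedes it below -/
import Mathlib

section
/- The Gray graph is a unit-distance graph: there exists an injective map f : ZMod 54 → ℝ² such that whenever two vertices u and v are adjacent in the Gray graph, the Euclidean distance between f(u) and f(v) equals 1. -/
/-- The LCF steps for the Gray graph: `[7, -7, 13, -13, 25, -25]^9`. -/
def lcfD (x : ZMod 6) : ℤ :=
  if x = 0 then 7 else if x = 1 then -7 else if x = 2 then 13
  else if x = 3 then -13 else if x = 4 then 25 else -25

/-- The Gray graph on `ZMod 54`, given by the LCF notation `[7, -7, 13, -13, 25, -25]^9`: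
`u` and `v` are adjacent iff `v = u + 1`, or `u = v + 1`, or `v = u + d(u mod 6)`,
or `u = v + d(v mod 6)`. -/
def grayGraph : SimpleGraph (ZMod 54) :=
  SimpleGraph.fromRel (fun u v => v = u + 1 ∨ v = u + ((lcfD ((u.val : ZMod 6))) : ZMod 54))

/-- Three triples of integer vectors of length `25`, each preceded by the zero vector. -/
def grayVec : Fin 3 → Fin 4 → ℤ × ℤ :=
  ![![(0, 0), (-20, 15), (24, 7), (-24, 7)],
    ![(0, 0), (-7, 24), (-20, -15), (-7, -24)],
    ![(0, 0), (7, 24), (15, 20), (15, -20)]]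

/-- An identification of the Gray graph with the incidence graph of the `3 × 3 × 3` grid.
A point of the grid is a triple with nonzero entries, and a line of the grid is a triple in
which the free coordinate is `0`. -/
def grayLabel : Fin 54 → Fin 3 → Fin 4 :=
  ![![0, 1, 1], ![2, 1, 1], ![2, 0, 1], ![2, 3, 1], ![0, 3, 1], ![3, 3, 1],
    ![3, 0, 1], ![3, 1, 1], ![3, 1, 0], ![3, 1, 3], ![3, 0, 3], ![3, 2, 3],
    ![3, 2, 0], ![3, 2, 1], ![0, 2, 1], ![2, 2, 1], ![2, 2, 0], ![2, 2, 2],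
    ![0, 2, 2], ![3, 2, 2], ![3, 0, 2], ![3, 1, 2], ![0, 1, 2], ![1, 1, 2],
    ![1, 0, 2], ![1, 2, 2], ![1, 2, 0], ![1, 2, 1], ![1, 0, 1], ![1, 3, 1],
    ![1, 3, 0], ![1, 3, 2], ![0, 3, 2], ![3, 3, 2], ![3, 3, 0], ![3, 3, 3],
    ![0, 3, 3], ![1, 3, 3], ![1, 0, 3], ![1, 2, 3], ![0, 2, 3], ![2, 2, 3],
    ![2, 0, 3], ![2, 3, 3], ![2, 3, 0], ![2, 3, 2], ![2, 0, 2], ![2, 1, 2],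
    ![2, 1, 0], ![2, 1, 3], ![0, 1, 3], ![1, 1, 3], ![1, 1, 0], ![1, 1, 1]]

/-- The unit-distance drawing of the Gray graph, scaled by `25`: each vertex is placed at the sum
of the vectors selected by its label, so that incident points and lines differ by exactly one
vector of length `25`. -/
def grayCoord (u : ZMod 54) : ℤ × ℤ :=
  grayVec 0 (grayLabel u 0) + grayVec 1 (grayLabel u 1) + grayVec 2 (grayLabel u 2)

theorem grayCoord_injective : Function.Injective grayCoord := by
  decide +kernel

theorem grayCoord_sq_dist (u v : ZMod 54)
    (h : v = u + 1 ∨ v = u + ((lcfD ((u.val : ZMod 6))) : ZMod 54)) :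
    ((grayCoord u).1 - (grayCoord v).1) ^ 2 + ((grayCoord u).2 - (grayCoord v).2) ^ 2 = 25 ^ 2 := by
  revert u v
  decide +kernel

theorem gray_graph_unit_distance :
    ∃ f : ZMod 54 → EuclideanSpace ℝ (Fin 2),
      Function.Injective f ∧
      ∀ u v : ZMod 54, grayGraph.Adj u v → dist (f u) (f v) = 1 := by
  let f : ZMod 54 → EuclideanSpace ℝ (Fin 2) :=
    fun u => !₂[((grayCoord u).1 : ℝ) / 25, ((grayCoord u).2 : ℝ) / 25]
  have dist_eq_one (u v : ZMod 54)
      (h : v = u + 1 ∨ v = u + ((lcfD ((u.val : ZMod 6))) : ZMod 54)) :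
      dist (f u) (f v) = 1 := by
    have key : (((grayCoord u).1 : ℝ) - (grayCoord v).1) ^ 2 +
        (((grayCoord u).2 : ℝ) - (grayCoord v).2) ^ 2 = 25 ^ 2 := by
      exact_mod_cast grayCoord_sq_dist u v h
    rw [EuclideanSpace.dist_eq, Real.sqrt_eq_one]
    simp only [f, Fin.sum_univ_two, Real.dist_eq, sq_abs, Matrix.cons_val_zero,
      Matrix.cons_val_one]
    linear_combination key / 25 ^ 2
  refine ⟨f, fun u v h => grayCoord_injective (Prod.ext ?_ ?_), fun u v h => ?_⟩
  · simpa [f] using congrArg (fun x : EuclideanSpace ℝ (Fin 2) => x 0) h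
  · simpa [f] using congrArg (fun x : EuclideanSpace ℝ (Fin 2) => x 1) h
  · rcases ((SimpleGraph.fromRel_adj _ u v).1 h).2 with h | h
    · exact dist_eq_one u v h
    · rw [dist_comm]
      exact dist_eq_one v u h
end

section
/- The map ρ : ZMod 54 → ZMod 54 given by ρ(v) = v + 18 is a graph automorphism of the Gray graph; moreover ρ has order 3 (ρ∘ρ∘ρ = id and ρ ≠ id) and ρ is semiregular, i.e. ρ(v) ≠ v for every vertex v. -/
theorem ZMod.natCast_val_add_eighteen (v : ZMod 54) :
    ((v + 18).val : ZMod 6) = (v.val : ZMod 6) := by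
  revert v
  decide

theorem grayGraph_adj_add_eighteen_iff (u v : ZMod 54) :
    grayGraph.Adj (u + 18) (v + 18) ↔ grayGraph.Adj u v := by
  simp only [grayGraph, SimpleGraph.fromRel_adj, ZMod.natCast_val_add_eighteen,
    add_right_comm _ (18 : ZMod 54), add_left_inj, ne_eq]

theorem gray_graph_rho_automorphism :
    ∃ φ : grayGraph ≃g grayGraph,
      (∀ v : ZMod 54, φ v = v + 18) ∧
      (∀ v : ZMod 54, φ (φ (φ v)) = v) ∧
      (∃ v : ZMod 54, φ v ≠ v) ∧
      (∀ v : ZMod 54, φ v ≠ v) := by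
  have add_ne_self (v : ZMod 54) : v + 18 ≠ v := by
    rw [Ne, add_eq_left]
    decide
  refine ⟨⟨Equiv.addRight 18, grayGraph_adj_add_eighteen_iff _ _⟩, fun _ => rfl, fun v => ?_,
    ⟨0, add_ne_self 0⟩, add_ne_self⟩
  change v + 18 + 18 + 18 = v
  rw [add_assoc, add_assoc, add_eq_left]
  decide
end

section
/- The girth of the Gray graph equals 8, i.e. the shortest cycle in the Gray graph has length 8. -/
namespace SimpleGraph

variable {V : Type*} [DecidableEq V]

/-- `avoids N t k p c` states that no walk of length at most `k` from `c` to `t`, all of whose steps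
follow the neighbour lists `N`, is non-backtracking when preceded by the step from `p` to `c`. -/
def avoids (N : V → List V) (t : V) : ℕ → V → V → Bool
  | 0, _, c => c ≠ t
  | k + 1, p, c => c ≠ t && (N c).all fun w => w == p || avoids N t k c w

theorem avoids_map {N : V → List V} {f : V → V} (hf : f.Injective)
    (hN : ∀ u, N (f u) = (N u).map f) (t : V) (k : ℕ) (p c : V) :
    avoids N (f t) k (f p) (f c) = avoids N t k p c := by
  induction k generalizing p c with
  | zero => simp [avoids, hf.eq_iff]
  | succ k ih => simp [avoids, hN, hf.eq_iff, ih, Function.comp_def, Bool.beq_eq_decide_eq]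

variable {G : SimpleGraph V} {N : V → List V}

theorem Walk.IsTrail.lt_length_of_avoids (hN : ∀ u v, G.Adj u v → v ∈ N u) {c t : V}
    {w : G.Walk c t} (hw : w.IsTrail) {p : V} (hp : s(p, c) ∉ w.edges) {k : ℕ}
    (h : avoids N t k p c = true) : k < w.length := by
  induction w generalizing p k with
  | nil => cases k <;> simp [avoids] at h
  | @cons c v t hcv q ih =>
    cases k with
    | zero => simp
    | succ k =>
      rw [Walk.isTrail_cons] at hw
      simp only [avoids, Bool.and_eq_true, List.all_eq_true, Bool.or_eq_true, beq_iff_eq] at h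
      obtain rfl | hv := h.2 v (hN _ _ hcv)
      · simp [Sym2.eq_swap] at hp
      · simpa using ih hw.1 hw.2 hv

theorem le_girth_of_avoids (hN : ∀ u v, G.Adj u v → v ∈ N u) {k : ℕ} (hG : ¬ G.IsAcyclic)
    (h : ∀ a, ∀ v ∈ N a, avoids N a k a v = true) : k + 2 ≤ G.girth := by
  obtain ⟨a, w, hw, hlen⟩ := exists_girth_eq_length.2 hG
  rw [hlen]
  cases w with
  | nil => exact absurd rfl hw.ne_nil
  | cons hav q =>
    have ht := (Walk.isTrail_cons _ _).1 hw.isTrail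
    have := ht.1.lt_length_of_avoids hN ht.2 (h a _ (hN _ _ hav))
    rw [Walk.length_cons]
    lia

end SimpleGraph

open SimpleGraph

def grayChord (u : ZMod 54) : ZMod 54 :=
  u + ((lcfD ((u.val : ZMod 6))) : ZMod 54)

def grayNeighbors (u : ZMod 54) : List (ZMod 54) :=
  [u + 1, u - 1, grayChord u]

theorem grayChord_involutive : Function.Involutive grayChord := by
  unfold Function.Involutive
  decide +kernel

theorem mem_grayNeighbors_of_adj (u v : ZMod 54) (h : grayGraph.Adj u v) :
    v ∈ grayNeighbors u := by
  simp only [grayNeighbors, List.mem_cons, List.not_mem_nil, or_false]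
  obtain ⟨-, (h | h) | h | h⟩ := h
  · exact .inl h
  · exact .inr (.inr h)
  · exact .inr (.inl (eq_sub_of_add_eq h.symm))
  · exact .inr (.inr (grayChord_involutive.eq_iff.1 h.symm))

instance : DecidableRel grayGraph.Adj := fun u v => by
  unfold grayGraph
  infer_instance

theorem grayNeighbors_add_six (u : ZMod 54) :
    grayNeighbors (u + 6) = (grayNeighbors u).map (· + 6) := by
  revert u
  decide +kernel

theorem avoids_grayNeighbors (a v : ZMod 54) (hv : v ∈ grayNeighbors a) :
    avoids grayNeighbors a 6 a v = true := by
  have hbase : ∀ r ∈ List.range 6,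
      ∀ v ∈ grayNeighbors r, avoids grayNeighbors r 6 r v = true := by
    decide +kernel
  have hrot (r : ℕ) (hr : r < 6) (q : ℕ) :
      ∀ v ∈ grayNeighbors (r + q * 6),
        avoids grayNeighbors (r + q * 6) 6 (r + q * 6) v = true := by
    induction q with
    | zero => simpa using hbase r (List.mem_range.2 hr)
    | succ q ih =>
      rw [Nat.cast_succ, add_one_mul, ← add_assoc, grayNeighbors_add_six]
      simpa [avoids_map (add_left_injective 6) grayNeighbors_add_six] using ih
  have ha : ((a.val % 6 : ℕ) : ZMod 54) + (a.val / 6 : ℕ) * 6 = a := by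
    have h := congrArg (Nat.cast (R := ZMod 54)) (Nat.mod_add_div' a.val 6)
    rwa [Nat.cast_add, Nat.cast_mul, ZMod.natCast_zmod_val] at h
  have h := hrot _ (Nat.mod_lt a.val (by norm_num)) (a.val / 6)
  rw [ha] at h
  exact h v hv

/-- The edge `0 — 7` closes the path `0, 1, …, 7` to an octagon. -/
def grayOctagon : grayGraph.Walk 0 0 :=
  .cons (v := 1) (by decide +kernel) <| .cons (v := 2) (by decide +kernel) <|
  .cons (v := 3) (by decide +kernel) <| .cons (v := 4) (by decide +kernel) <|
  .cons (v := 5) (by decide +kernel) <| .cons (v := 6) (by decide +kernel) <|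
  .cons (v := 7) (by decide +kernel) <| .cons (by decide +kernel) .nil

theorem isCycle_grayOctagon : grayOctagon.IsCycle := by
  rw [Walk.isCycle_def, Walk.isTrail_def]
  refine ⟨?_, by simp [grayOctagon], ?_⟩ <;> decide +kernel

theorem gray_graph_girth : grayGraph.girth = 8 :=
  le_antisymm (girth_le_length isCycle_grayOctagon) <|
    le_girth_of_avoids mem_grayNeighbors_of_adj (fun h => h _ isCycle_grayOctagon)
      avoids_grayNeighbors
end
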